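/- arXiv:1910.10923 — 3 statements merged into one kernel-verified Lean document; each statement's English description precedes it below -/
import Mathlib

section
/- Let F(t) = 1/2 + arctan(t)/pi be the cumulative distribution function of the standard Cauchy distribution, let gamma = 2·tan(pi/8) and alpha = 1/4. Then for every r >= 0 with 18r <= tan(pi/8), one has F(gamma - 18r) - F(18r - gamma) >= 1/4. In particular, the local Bernstein condition F_eps(gamma - 18r) - F_eps(18r - gamma) >= alpha required for Huber regression is verified by standard Cauchy noise with alpha = 1/4 and gamma = 2·tan(pi/8) whenever 18r <= tan(pi/8). -/
open Real

/-- The local Bernstein condition for Huber regression is verified by standard Cauchy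
noise with `α = 1/4` and `γ = 2 tan (π/8)`: with `F(t) = 1/2 + arctan t / π` the cdf of
the standard Cauchy distribution, for every `r ≥ 0` with `18 r ≤ tan (π/8)` one has
`F(γ - 18r) - F(18r - γ) ≥ 1/4`. -/
theorem cauchy_local_bernstein_condition
    (F : ℝ → ℝ) (hF : ∀ t, F t = 1 / 2 + Real.arctan t / π)
    (γ α : ℝ) (hγ : γ = 2 * Real.tan (π / 8)) (hα : α = 1 / 4) :
    ∀ r : ℝ, 0 ≤ r → 18 * r ≤ Real.tan (π / 8) →
      α ≤ F (γ - 18 * r) - F (18 * r - γ) := by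
  intro r _ hr
  have harctan : π / 8 ≤ arctan (γ - 18 * r) := by
    rw [← arctan_tan (x := π / 8) (by linarith [pi_pos]) (by linarith [pi_pos])]
    exact arctan_mono (by linarith)
  rw [hF, hF, ← neg_sub γ, arctan_neg, hα]
  have hdiv : 1 / 8 ≤ arctan (γ - 18 * r) / π := by
    rw [le_div_iff₀ pi_pos]
    linarith
  rw [neg_div]
  linarith
end

section
/- Let P1 and P2 be probability measures on a measurable space with total variation distance t := TV(P1,P2) in (0,1], and set eps' = t/(1+t). Let Q1 = (1/t)·(P2 - P1)_+ and Q2 = (1/t)·(P1 - P2)_+, where (P2 - P1)_+ and (P1 - P2)_+ denote the positive parts in the Jordan decomposition of the signed measure P2 - P1. Then Q1 and Q2 are probability measures, and the two contaminated mixtures coincide: (1 - eps')·P1 + eps'·Q1 = (1 - eps')·P2 + eps'·Q2. In particular, the eps'-contaminated models around P1 and around P2 contain a common distribution, so P1 and P2 are not identifiable from eps'-contaminated samples. -/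
open MeasureTheory

/-- Two finite measures agree after adding to each the part of the other exceeding it. -/
lemma add_posPart_eq_add_posPart {Ω : Type*} [MeasurableSpace Ω] (μ ν : Measure Ω)
    [IsFiniteMeasure μ] [IsFiniteMeasure ν] :
    μ + (ν.toSignedMeasure - μ.toSignedMeasure).toJordanDecomposition.posPart =
      ν + (μ.toSignedMeasure - ν.toSignedMeasure).toJordanDecomposition.posPart := by
  have hneg : μ.toSignedMeasure - ν.toSignedMeasure
      = -(ν.toSignedMeasure - μ.toSignedMeasure) := (neg_sub _ _).symm
  rw [hneg, SignedMeasure.toJordanDecomposition_neg, JordanDecomposition.neg_posPart]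
  have h := SignedMeasure.toSignedMeasure_toJordanDecomposition
    (ν.toSignedMeasure - μ.toSignedMeasure)
  rw [JordanDecomposition.toSignedMeasure, sub_eq_sub_iff_add_eq_add] at h
  rw [← Measure.toSignedMeasure_eq_toSignedMeasure_iff, Measure.toSignedMeasure_add,
    Measure.toSignedMeasure_add, add_comm, h]

/-- Given two probability measures `P1, P2` with total variation distance
`t = (P2 - P1)₊(Ω) ∈ (0,1]`, setting `ε' = t/(1+t)`, `Q1 = t⁻¹ (P2 - P1)₊` and
`Q2 = t⁻¹ (P1 - P2)₊`, the measures `Q1, Q2` are probability measures and the two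
`ε'`-contaminated mixtures coincide:
`(1-ε') P1 + ε' Q1 = (1-ε') P2 + ε' Q2`. -/
theorem contaminated_mixtures_coincide
    {Ω : Type*} [MeasurableSpace Ω]
    (P1 P2 : Measure Ω) [IsProbabilityMeasure P1] [IsProbabilityMeasure P2]
    (t : ℝ)
    (ht : t = ((P2.toSignedMeasure - P1.toSignedMeasure).toJordanDecomposition.posPart
      Set.univ).toReal)
    (htpos : 0 < t) (htle : t ≤ 1)
    (Q1 Q2 : Measure Ω)
    (hQ1 : Q1 = (ENNReal.ofReal t)⁻¹ •
      (P2.toSignedMeasure - P1.toSignedMeasure).toJordanDecomposition.posPart)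
    (hQ2 : Q2 = (ENNReal.ofReal t)⁻¹ •
      (P1.toSignedMeasure - P2.toSignedMeasure).toJordanDecomposition.posPart)
    (ε' : ℝ) (hε' : ε' = t / (1 + t)) :
    IsProbabilityMeasure Q1 ∧ IsProbabilityMeasure Q2 ∧
      (ENNReal.ofReal (1 - ε')) • P1 + (ENNReal.ofReal ε') • Q1 =
        (ENNReal.ofReal (1 - ε')) • P2 + (ENNReal.ofReal ε') • Q2 := by
  have key := add_posPart_eq_add_posPart P1 P2
  set p := (P2.toSignedMeasure - P1.toSignedMeasure).toJordanDecomposition.posPart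
  set n := (P1.toSignedMeasure - P2.toSignedMeasure).toJordanDecomposition.posPart
  have hp : p Set.univ = ENNReal.ofReal t := by
    rw [ht, ENNReal.ofReal_toReal (measure_ne_top _ _)]
  have hn : n Set.univ = ENNReal.ofReal t := by
    have h := congrArg (fun μ : Measure Ω => μ Set.univ) key
    simp only [Measure.add_apply, measure_univ] at h
    rw [← hp]
    exact ((ENNReal.add_right_inj ENNReal.one_ne_top).1 h).symm
  have ht0 : ENNReal.ofReal t ≠ 0 := (ENNReal.ofReal_pos.2 htpos).ne'
  have hc : ENNReal.ofReal ε' * (ENNReal.ofReal t)⁻¹ = ENNReal.ofReal (1 - ε') := by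
    have h1 : ε' = (1 - ε') * t := by rw [hε']; field_simp; ring
    have h2 : 0 ≤ 1 - ε' := by
      have : 1 - ε' = 1 / (1 + t) := by rw [hε']; field_simp; ring
      rw [this]; positivity
    conv_lhs => rw [h1, ENNReal.ofReal_mul h2, mul_assoc,
      ENNReal.mul_inv_cancel ht0 ENNReal.ofReal_ne_top, mul_one]
  refine ⟨⟨?_⟩, ⟨?_⟩, ?_⟩
  · rw [hQ1, Measure.smul_apply, hp, smul_eq_mul,
      ENNReal.inv_mul_cancel ht0 ENNReal.ofReal_ne_top]
  · rw [hQ2, Measure.smul_apply, hn, smul_eq_mul,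
      ENNReal.inv_mul_cancel ht0 ENNReal.ofReal_ne_top]
  · rw [hQ1, hQ2, smul_smul, smul_smul, hc, ← smul_add, ← smul_add, key]
end

section
/- Let (E, ||·||) be a real normed vector space and let f*, f1 be in E. Then for every v in E and every continuous linear functional g on E with dual norm ||g||* <= 1 and g(v) = ||v|| (i.e. g is a subgradient of ||·|| at v), one has ||f1|| - ||f*|| >= g(f1 - f*) - 2·||f* - v||. In particular, if rho > 0 and ||f* - v|| <= rho/20, then ||f1|| - ||f*|| >= g(f1 - f*) - rho/10; hence, taking the supremum over all such pairs (v,g), ||f1|| - ||f*|| >= Delta - rho/10, where Delta is the supremum of g(f1 - f*) over all v with ||f* - v|| <= rho/20 and all norming functionals g at v. Consequently, if this supremum is at least (4/5)·rho (the sparsity equation), then ||f1|| - ||f*|| >= (7/10)·rho. -/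
/-- A functional norming for `v` satisfies an approximate subgradient inequality for the norm at
any point `x`, with error at most twice the distance from `x` to `v`. -/
theorem ContinuousLinearMap.map_sub_sub_two_mul_norm_le
    {E : Type*} [SeminormedAddCommGroup E] [NormedSpace ℝ E] {v : E} {g : E →L[ℝ] ℝ}
    (hg : ‖g‖ ≤ 1) (hv : g v = ‖v‖) (x y : E) :
    g (y - x) - 2 * ‖x - v‖ ≤ ‖y‖ - ‖x‖ := by
  have hle (z : E) : g z ≤ ‖z‖ :=
    (le_abs_self _).trans (by simpa using g.le_of_opNorm_le hg z)
  have h₁ := hle y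
  have h₂ := hle (v - x)
  have h₃ := norm_sub_norm_le x v
  rw [norm_sub_rev v x, map_sub] at h₂
  rw [map_sub]
  linarith


/-- In a real normed space, for any norming functional `g` at a point `v`
(`‖g‖* ≤ 1` and `g v = ‖v‖`), one has `‖f1‖ - ‖f*‖ ≥ g (f1 - f*) - 2‖f* - v‖`;
if moreover `‖f* - v‖ ≤ ρ/20` then `‖f1‖ - ‖f*‖ ≥ g (f1 - f*) - ρ/10`; and if the
supremum of `g (f1 - f*)` over all such pairs `(v, g)` with `‖f* - v‖ ≤ ρ/20` is at
least `(4/5) ρ` (the sparsity equation), then `‖f1‖ - ‖f*‖ ≥ (7/10) ρ`. -/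
theorem norm_subdifferential_lower_bound
    {E : Type*} [NormedAddCommGroup E] [NormedSpace ℝ E]
    (fstar f1 : E) (ρ : ℝ) (hρ : 0 < ρ) :
    (∀ (v : E) (g : E →L[ℝ] ℝ), ‖g‖ ≤ 1 → g v = ‖v‖ →
        g (f1 - fstar) - 2 * ‖fstar - v‖ ≤ ‖f1‖ - ‖fstar‖) ∧
    (∀ (v : E) (g : E →L[ℝ] ℝ), ‖g‖ ≤ 1 → g v = ‖v‖ → ‖fstar - v‖ ≤ ρ / 20 →
        g (f1 - fstar) - ρ / 10 ≤ ‖f1‖ - ‖fstar‖) ∧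
    (4 / 5 * ρ ≤ sSup {x : ℝ | ∃ (v : E) (g : E →L[ℝ] ℝ),
          ‖g‖ ≤ 1 ∧ g v = ‖v‖ ∧ ‖fstar - v‖ ≤ ρ / 20 ∧ x = g (f1 - fstar)} →
      7 / 10 * ρ ≤ ‖f1‖ - ‖fstar‖) := by
  have key (v : E) (g : E →L[ℝ] ℝ) (hg : ‖g‖ ≤ 1) (hv : g v = ‖v‖) (hd : ‖fstar - v‖ ≤ ρ / 20) :
      g (f1 - fstar) - ρ / 10 ≤ ‖f1‖ - ‖fstar‖ := by
    linarith [g.map_sub_sub_two_mul_norm_le hg hv fstar f1]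
  refine ⟨fun v g hg hv ↦ g.map_sub_sub_two_mul_norm_le hg hv fstar f1, key, fun h ↦ ?_⟩
  suffices hsup : _ ≤ ‖f1‖ - ‖fstar‖ + ρ / 10 by linarith [h.trans hsup]
  refine csSup_le (Set.nonempty_iff_ne_empty.2 fun he ↦ ?_) ?_
  · rw [he, Real.sSup_empty] at h
    linarith
  · rintro _ ⟨v, g, hg, hv, hd, rfl⟩
    linarith [key v g hg hv hd]
end
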